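/- arXiv:2103.01380 — 3 statements merged into one kernel-verified Lean document; each statement's English description precedes it below -/
import Mathlib

section
/- Let m, n, k be positive integers with k ≤ min(m, n), and let A be a real m × n matrix. Then there exist a set I ⊆ {0, …, n−1} with |I| = k and a real k × n matrix C such that: (1) the k × k submatrix of C formed by the columns indexed by I is the k × k identity matrix; (2) no entry of C has absolute value greater than 1; (3) the spectral norm of C satisfies ‖C‖₂ ≤ √(k(n−k) + 1); (4) the k-th largest singular value of C is at least 1; (5) if k = m or k = n, then A = A(:,I) C, where A(:,I) denotes the m × k submatrix of A formed by the columns indexed by I; and (6) ‖A − A(:,I) C‖₂ ≤ √(k(n−k) + 1) · σ_{k+1}(A), where σ_{k+1}(A) is the (k+1)-th largest singular value of A (interpreted as 0 when k = min(m,n)). -/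
open Matrix

/-- Spectral norm: the operator norm induced by the Euclidean vector norms. -/
noncomputable def specNorm {m n : Type*} [Fintype m] [Fintype n] [DecidableEq n]
    (A : Matrix m n ℝ) : ℝ :=
  ‖(Matrix.toEuclideanLin A).toContinuousLinearMap‖

open Classical in
/-- The `i`-th largest (1-indexed) eigenvalue of a real symmetric `n × n` matrix;
`0` if the matrix is not symmetric or `i ∉ {1, …, n}`. -/
noncomputable def ithLargestEig {n : ℕ} (S : Matrix (Fin n) (Fin n) ℝ) (i : ℕ) : ℝ :=
  if hS : S.IsHermitian then
    if h : 1 ≤ i ∧ i ≤ n then hS.eigenvalues (Tuple.sort hS.eigenvalues ⟨n - i, by omega⟩)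
    else 0
  else 0

/-- The `i`-th largest (1-indexed) singular value of a real `m × n` matrix: the square root
of the `i`-th largest eigenvalue of `AᵀA`. -/
noncomputable def singularValue {m n : ℕ} (A : Matrix (Fin m) (Fin n) ℝ) (i : ℕ) : ℝ :=
  Real.sqrt (ithLargestEig (Aᵀ * A) i)

/-- The submatrix of `A` formed by the columns indexed by the set `I` (of size `k`),
taken in increasing order. -/
noncomputable def colSub {m n k : ℕ} (A : Matrix (Fin m) (Fin n) ℝ)
    (I : Finset (Fin n)) (hI : I.card = k) : Matrix (Fin m) (Fin k) ℝ :=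
  A.submatrix id fun j => ((I.orderIsoOfFin hI j : Fin n))

theorem mulVec_dotProduct_self_le {κ ι : Type*} [Fintype κ] [Fintype ι]
    (M : Matrix κ ι ℝ) (s : Finset ι) (v : ι → ℝ) (hv : ∀ j, j ∉ s → v j = 0) :
    (M *ᵥ v) ⬝ᵥ (M *ᵥ v) ≤ (∑ i, ∑ j ∈ s, M i j ^ 2) * (v ⬝ᵥ v) := by
  have hsum : ∀ f : ι → ℝ, ∑ j, f j * v j = ∑ j ∈ s, f j * v j := fun f =>
    (Finset.sum_subset (Finset.subset_univ s) fun j _ hj => by simp [hv j hj]).symm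
  simp only [dotProduct, mulVec, hsum, Finset.sum_mul (s := Finset.univ)]
  refine Finset.sum_le_sum fun i _ => ?_
  simpa only [← sq] using Finset.sum_mul_sq_le_sq_mul_sq s (M i) v

theorem det_add_single {κ : Type*} [Fintype κ] [DecidableEq κ] (M : Matrix κ κ ℝ) (i : κ) (s : ℝ) :
    (M + Matrix.single i i s).det = M.det + s * M.adjugate i i := by
  have h : M + Matrix.single i i s = M.updateRow i (M i + s • Pi.single i 1) := by
    ext a b
    by_cases ha : a = i
    · subst ha
      by_cases hb : b = a
      · subst hb; simp
      · simp [hb, Ne.symm hb]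
    · simp [Matrix.updateRow_ne ha, Ne.symm ha]
  rw [h, det_updateRow_add, det_updateRow_smul, adjugate_apply, updateRow_eq_self]

theorem det_one_updateCol {κ : Type*} [Fintype κ] [DecidableEq κ] (i : κ) (v : κ → ℝ) :
    ((1 : Matrix κ κ ℝ).updateCol i v).det = v i := by
  rw [← cramer_apply, cramer_one]; rfl

theorem adjugate_one_updateCol {κ : Type*} [Fintype κ] [DecidableEq κ] (i : κ) (v : κ → ℝ) :
    ((1 : Matrix κ κ ℝ).updateCol i v).adjugate i = Pi.single i 1 := by
  ext j
  rw [← transpose_apply (adjugate _), adjugate_transpose, adjugate_apply, updateRow_transpose,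
    det_transpose, updateCol_idem, det_one_updateCol]
  simp [Pi.single_apply, eq_comm]

theorem det_conj_add_single {κ : Type*} [Fintype κ] [DecidableEq κ] (H : Matrix κ κ ℝ) (i : κ)
    (v : κ → ℝ) (s : ℝ) :
    (((1 : Matrix κ κ ℝ).updateCol i v)ᵀ * H * (1 : Matrix κ κ ℝ).updateCol i v +
      Matrix.single i i s).det = v i ^ 2 * H.det + s * H.adjugate i i := by
  rw [det_add_single, det_mul, det_mul, det_transpose, det_one_updateCol, adjugate_mul_distrib,
    adjugate_mul_distrib, ← adjugate_transpose, ← Matrix.mul_assoc, Matrix.mul_apply]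
  simp only [Matrix.mul_apply, adjugate_one_updateCol, transpose_apply]
  simp [Pi.single_apply]
  ring


theorem Matrix.IsHermitian.dotProduct_self_eq_sum {n : Type*} [Fintype n] [DecidableEq n]
    {S : Matrix n n ℝ} (hS : S.IsHermitian) (x : n → ℝ) :
    x ⬝ᵥ x = ∑ j, ((hS.eigenvectorBasis j).ofLp ⬝ᵥ x) ^ 2 := by
  have h := hS.eigenvectorBasis.sum_inner_mul_inner (WithLp.toLp 2 x) (WithLp.toLp 2 x)
  simp only [EuclideanSpace.inner_eq_star_dotProduct, star_trivial] at h
  rw [← h]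
  refine Finset.sum_congr rfl fun j _ => ?_
  rw [dotProduct_comm x, sq]

theorem Matrix.IsHermitian.dotProduct_mulVec_eq_sum {n : Type*} [Fintype n] [DecidableEq n]
    {S : Matrix n n ℝ} (hS : S.IsHermitian) (x : n → ℝ) :
    x ⬝ᵥ (S *ᵥ x) = ∑ j, hS.eigenvalues j * ((hS.eigenvectorBasis j).ofLp ⬝ᵥ x) ^ 2 := by
  have h := hS.eigenvectorBasis.sum_inner_mul_inner (WithLp.toLp 2 x) (WithLp.toLp 2 (S *ᵥ x))
  simp only [EuclideanSpace.inner_eq_star_dotProduct, star_trivial] at h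
  rw [dotProduct_comm, ← h]
  refine Finset.sum_congr rfl fun j _ => ?_
  have hT : S.IsSymm := by simpa using hS
  rw [dotProduct_comm (S *ᵥ x), dotProduct_mulVec, ← mulVec_transpose, hT.eq,
    hS.mulVec_eigenvectorBasis, smul_dotProduct, smul_eq_mul]
  ring

theorem Matrix.PosSemidef.dotProduct_mulVec_le_trace {n : Type*} [Fintype n]
    {S : Matrix n n ℝ} (hS : S.PosSemidef) (x : n → ℝ) :
    x ⬝ᵥ (S *ᵥ x) ≤ S.trace * (x ⬝ᵥ x) := by
  classical
  have htr : S.trace = ∑ j, hS.1.eigenvalues j := by simpa using hS.1.trace_eq_sum_eigenvalues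
  rw [hS.1.dotProduct_mulVec_eq_sum, hS.1.dotProduct_self_eq_sum, Finset.mul_sum]
  refine Finset.sum_le_sum fun j _ => mul_le_mul_of_nonneg_right ?_ (sq_nonneg _)
  rw [htr]
  exact Finset.single_le_sum (f := hS.1.eigenvalues) (fun i _ => hS.eigenvalues_nonneg i)
    (Finset.mem_univ j)

theorem Matrix.PosDef.dotProduct_self_le_trace_inv {n : Type*} [Fintype n] [DecidableEq n]
    [Nonempty n] {H : Matrix n n ℝ} (hH : H.PosDef) (q : n → ℝ) :
    q ⬝ᵥ q ≤ H⁻¹.trace * (q ⬝ᵥ (H *ᵥ q)) := by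
  set N := H⁻¹.trace with hN
  have hpos : 0 < N := hH.inv.trace_pos
  have h1 : q ⬝ᵥ (H⁻¹ *ᵥ q) ≤ N * (q ⬝ᵥ q) := hH.inv.posSemidef.dotProduct_mulVec_le_trace q
  have h2 := hH.inv.posSemidef.dotProduct_mulVec_nonneg (q - N • (H *ᵥ q))
  have hu : IsUnit H.det := (isUnit_iff_isUnit_det _).1 hH.isUnit
  have h3 : H⁻¹ *ᵥ (H *ᵥ q) = q := by
    rw [mulVec_mulVec, nonsing_inv_mul _ hu, one_mulVec]
  have hT : H⁻¹.IsSymm := by simpa using hH.inv.1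
  have h4 : (H *ᵥ q) ⬝ᵥ (H⁻¹ *ᵥ q) = q ⬝ᵥ q := by
    rw [dotProduct_mulVec, ← mulVec_transpose, hT.eq, h3]
  simp only [star_trivial, mulVec_sub, mulVec_smul, h3, sub_dotProduct, dotProduct_sub,
    smul_dotProduct, dotProduct_smul, smul_eq_mul, h4, dotProduct_comm (H *ᵥ q) q] at h2
  nlinarith

theorem le_ithLargestEig {n i : ℕ} {S : Matrix (Fin n) (Fin n) ℝ} (hS : S.IsHermitian)
    (hi : 1 ≤ i) (hin : i ≤ n) {E : Type*} [AddCommGroup E] [Module ℝ E] [FiniteDimensional ℝ E]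
    (hE : Module.finrank ℝ E = i) (φ : E →ₗ[ℝ] (Fin n → ℝ)) (hφ : Function.Injective φ) (c : ℝ)
    (hc : ∀ y, c * (φ y ⬝ᵥ φ y) ≤ φ y ⬝ᵥ (S *ᵥ φ y)) : c ≤ ithLargestEig S i := by
  rw [ithLargestEig, dif_pos hS, dif_pos ⟨hi, hin⟩]
  set σ := Tuple.sort hS.eigenvalues
  have hmono : Monotone (hS.eigenvalues ∘ σ) := Tuple.monotone_sort _
  set a : Fin n := ⟨n - i, by omega⟩ with ha
  let L : E →ₗ[ℝ] ({j : Fin n // j ∈ Finset.Ioi a} → ℝ) :=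
    LinearMap.pi fun j => (dotProductBilin ℝ ℝ (hS.eigenvectorBasis (σ j)).ofLp) ∘ₗ φ
  have hcard : Module.finrank ℝ ({j : Fin n // j ∈ Finset.Ioi a} → ℝ) < Module.finrank ℝ E := by
    rw [Module.finrank_fintype_fun_eq_card, Fintype.card_coe, Fin.card_Ioi, hE, ha]
    simp only
    omega
  obtain ⟨y, hy, hy0⟩ := (Submodule.ne_bot_iff _).1 (LinearMap.ker_ne_bot_of_finrank_lt hcard)
  have hL : ∀ j, a < j → (hS.eigenvectorBasis (σ j)).ofLp ⬝ᵥ φ y = 0 := fun j hj => by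
    have h : L y = 0 := hy
    exact congrFun h ⟨j, Finset.mem_Ioi.2 hj⟩
  have hpos : 0 < φ y ⬝ᵥ φ y := by
    have : φ y ≠ 0 := fun h => hy0 (hφ (by rw [h, map_zero]))
    simpa using dotProduct_star_self_pos_iff.2 this
  refine le_of_mul_le_mul_right ((hc y).trans ?_) hpos
  rw [hS.dotProduct_mulVec_eq_sum, hS.dotProduct_self_eq_sum, Finset.mul_sum,
    ← Equiv.sum_comp σ fun j => hS.eigenvalues j * ((hS.eigenvectorBasis j).ofLp ⬝ᵥ φ y) ^ 2,
    ← Equiv.sum_comp σ fun j => _ * ((hS.eigenvectorBasis j).ofLp ⬝ᵥ φ y) ^ 2]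
  refine Finset.sum_le_sum fun j _ => ?_
  rcases le_or_gt j a with h | h
  · exact mul_le_mul_of_nonneg_right (hmono h) (sq_nonneg _)
  · simp [hL j h]

theorem ithLargestEig_transpose_mul_self_eq_zero {m n i : ℕ} (A : Matrix (Fin m) (Fin n) ℝ)
    (hi : m < i) : ithLargestEig (Aᵀ * A) i = 0 := by
  have hP : (Aᵀ * A).PosSemidef := by simpa using posSemidef_conjTranspose_mul_self A
  rw [ithLargestEig, dif_pos hP.1]
  split_ifs with h
  swap
  · rfl
  by_contra hne
  set σ := Tuple.sort hP.1.eigenvalues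
  have hmono : Monotone (hP.1.eigenvalues ∘ σ) := Tuple.monotone_sort _
  have hpos := (hP.eigenvalues_nonneg _).lt_of_ne' hne
  have hrank : (Aᵀ * A).rank ≤ m :=
    (rank_mul_le_right _ _).trans ((rank_le_card_height A).trans_eq (Fintype.card_fin m))
  rw [hP.1.rank_eq_card_non_zero_eigs] at hrank
  let f : {j : Fin n // j ∈ Finset.Ici (⟨n - i, by omega⟩ : Fin n)} →
      {j // hP.1.eigenvalues j ≠ 0} :=
    fun j => ⟨σ j, (hpos.trans_le (hmono (Finset.mem_Ici.1 j.2))).ne'⟩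
  have hf : Function.Injective f := fun x y hxy =>
    Subtype.ext (σ.injective (Subtype.ext_iff.1 hxy))
  have := Fintype.card_le_of_injective f hf
  rw [Fintype.card_coe, Fin.card_Ici] at this
  simp only at this
  omega

theorem mulVec_dotProduct {κ ι : Type*} [Fintype κ] [Fintype ι] (M : Matrix κ ι ℝ)
    (x : ι → ℝ) (y : κ → ℝ) : (M *ᵥ x) ⬝ᵥ y = x ⬝ᵥ (Mᵀ *ᵥ y) := by
  rw [dotProduct_mulVec, vecMul_transpose]

theorem dotProduct_self_add_le {κ : Type*} [Fintype κ] {q r : κ → ℝ} {s X Y a b : ℝ} (hs : 0 ≤ s)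
    (hX : 0 ≤ X) (hY : 0 ≤ Y) (ha : 0 ≤ a) (hb : 0 ≤ b) (hq : s * (q ⬝ᵥ q) ≤ X * a)
    (hr : s * (r ⬝ᵥ r) ≤ Y * b) : s * ((q + r) ⬝ᵥ (q + r)) ≤ (X + Y) * (a + b) := by
  have hcs : (q ⬝ᵥ r) ^ 2 ≤ (q ⬝ᵥ q) * (r ⬝ᵥ r) := by
    simpa only [dotProduct, ← sq] using Finset.sum_mul_sq_le_sq_mul_sq Finset.univ q r
  have hrr : 0 ≤ r ⬝ᵥ r := by simpa using dotProduct_star_self_nonneg r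
  have h1 : (2 * (s * (q ⬝ᵥ r))) ^ 2 ≤ (X * b + Y * a) ^ 2 := by
    have h2 : s * (q ⬝ᵥ q) * (s * (r ⬝ᵥ r)) ≤ X * a * (Y * b) :=
      mul_le_mul hq hr (by positivity) (by positivity)
    have h3 : s ^ 2 * (q ⬝ᵥ r) ^ 2 ≤ s ^ 2 * ((q ⬝ᵥ q) * (r ⬝ᵥ r)) := by gcongr
    nlinarith [sq_nonneg (X * b - Y * a)]
  have h4 := abs_le_of_sq_le_sq' h1 (by positivity)
  simp only [add_dotProduct, dotProduct_add, dotProduct_comm r q]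
  nlinarith [h4.2]

/-- The Gram form on the span of the chosen columns and one further vector dominates the Schur
complement energy of that vector. -/
theorem schur_energy_le {k n : ℕ} [Nonempty (Fin k)] {G S : Matrix (Fin n) (Fin n) ℝ}
    {J : Matrix (Fin n) (Fin k) ℝ} {H : Matrix (Fin k) (Fin k) ℝ} {C : Matrix (Fin k) (Fin n) ℝ}
    (hH : H.PosDef) (hJJ : Jᵀ * J = 1) (hCJ : C * J = 1) (hGJ : G * J = Cᵀ * H)
    (hS : S = G - Cᵀ * H * C) (hJS : Jᵀ * S = 0) (hS0 : S.PosSemidef) {v : Fin n → ℝ}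
    (hv : Jᵀ *ᵥ v = 0) {τ : ℝ} (hτ : (C *ᵥ v) ⬝ᵥ (C *ᵥ v) ≤ τ * (v ⬝ᵥ v)) (hτ0 : 0 ≤ τ)
    (p : Fin k → ℝ) (t : ℝ) :
    (v ⬝ᵥ (S *ᵥ v)) * ((J *ᵥ p + t • v) ⬝ᵥ (J *ᵥ p + t • v)) ≤
      ((S.trace * H⁻¹.trace + τ + 1) * (v ⬝ᵥ v)) *
        ((J *ᵥ p + t • v) ⬝ᵥ (G *ᵥ (J *ᵥ p + t • v))) := by
  have hvv : 0 ≤ v ⬝ᵥ v := by simpa using dotProduct_star_self_nonneg v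
  set q := p + t • (C *ᵥ v) with hq
  have hz : (J *ᵥ p + t • v) ⬝ᵥ (J *ᵥ p + t • v) = p ⬝ᵥ p + t ^ 2 * (v ⬝ᵥ v) := by
    have h1 : (J *ᵥ p) ⬝ᵥ (J *ᵥ p) = p ⬝ᵥ p := by
      rw [mulVec_dotProduct, mulVec_mulVec, hJJ, one_mulVec]
    have h2 : (J *ᵥ p) ⬝ᵥ v = 0 := by rw [mulVec_dotProduct, hv, dotProduct_zero]
    simp only [add_dotProduct, dotProduct_add, smul_dotProduct, dotProduct_smul, smul_eq_mul, h1,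
      h2, dotProduct_comm v (J *ᵥ p)]
    ring
  have hGz : G *ᵥ (J *ᵥ p + t • v) = Cᵀ *ᵥ (H *ᵥ q) + t • (S *ᵥ v) := by
    rw [hq, mulVec_add, mulVec_mulVec, hGJ, hS]
    simp only [mulVec_smul, mulVec_add, sub_mulVec, ← mulVec_mulVec, smul_sub]
    abel
  have hCz : C *ᵥ (J *ᵥ p + t • v) = q := by
    rw [mulVec_add, mulVec_mulVec, hCJ, one_mulVec, mulVec_smul]
  have hzG : (J *ᵥ p + t • v) ⬝ᵥ (G *ᵥ (J *ᵥ p + t • v)) =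
      q ⬝ᵥ (H *ᵥ q) + t ^ 2 * (v ⬝ᵥ (S *ᵥ v)) := by
    have h : (J *ᵥ p) ⬝ᵥ (S *ᵥ v) = 0 := by
      rw [mulVec_dotProduct, mulVec_mulVec, hJS, zero_mulVec, dotProduct_zero]
    rw [hGz, dotProduct_add, ← mulVec_dotProduct, hCz, dotProduct_smul, add_dotProduct (J *ᵥ p), h,
      smul_dotProduct]
    simp only [smul_eq_mul]
    ring
  rw [hz, hzG]
  have hs : 0 ≤ v ⬝ᵥ (S *ᵥ v) := by simpa using hS0.dotProduct_mulVec_nonneg v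
  have ha : 0 ≤ q ⬝ᵥ (H *ᵥ q) := by simpa using hH.posSemidef.dotProduct_mulVec_nonneg q
  have hN : 0 < H⁻¹.trace := hH.inv.trace_pos
  have hT : 0 ≤ S.trace := hS0.trace_nonneg
  have hle := dotProduct_self_add_le (q := q) (r := -(t • (C *ᵥ v))) (s := v ⬝ᵥ (S *ᵥ v))
    (X := S.trace * H⁻¹.trace * (v ⬝ᵥ v)) (Y := τ * (v ⬝ᵥ v)) (a := q ⬝ᵥ (H *ᵥ q))
    (b := t ^ 2 * (v ⬝ᵥ (S *ᵥ v))) hs (by positivity) (by positivity) ha (by positivity)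
    (by
      calc _ ≤ (S.trace * (v ⬝ᵥ v)) * (H⁻¹.trace * (q ⬝ᵥ (H *ᵥ q))) :=
            mul_le_mul (hS0.dotProduct_mulVec_le_trace v) (hH.dotProduct_self_le_trace_inv q)
              (by simpa using dotProduct_star_self_nonneg q) (by positivity)
        _ = _ := by ring)
    (by
      simp only [neg_dotProduct, dotProduct_neg, smul_dotProduct, dotProduct_smul, smul_eq_mul]
      nlinarith [mul_le_mul_of_nonneg_left hτ (mul_nonneg (sq_nonneg t) hs)])
  rw [show q + -(t • (C *ᵥ v)) = p by rw [hq]; abel] at hle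
  nlinarith [mul_nonneg hvv ha]

theorem exists_strictMono_det_submatrix_max {k n : ℕ} (hkn : k ≤ n)
    {G : Matrix (Fin n) (Fin n) ℝ} (hG : G.PosDef) :
    ∃ g : Fin k → Fin n, StrictMono g ∧
      ∀ f : Fin k → Fin n, (G.submatrix f f).det ≤ (G.submatrix g g).det := by
  have : Nonempty (Fin k → Fin n) := ⟨Fin.castLE hkn⟩
  obtain ⟨g, hg⟩ := Finite.exists_max fun f : Fin k → Fin n => (G.submatrix f f).det
  have hpos : 0 < (G.submatrix g g).det :=
    ((hG.submatrix (Fin.castLE_injective hkn)).det_pos).trans_le (hg _)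
  have hinj : Function.Injective g := by
    intro a b hab
    by_contra hne
    exact hpos.ne' (det_zero_of_row_eq hne (by ext c; simp [hab]))
  refine ⟨g ∘ Tuple.sort g, (Tuple.monotone_sort g).strictMono_of_injective
    (hinj.comp (Tuple.sort g).injective), fun f => ?_⟩
  have h := det_submatrix_equiv_self (Tuple.sort g) (G.submatrix g g)
  rw [submatrix_submatrix] at h
  rw [h]
  exact hg f

/-- Exchanging one selected index multiplies the principal minor by the given factor. -/
theorem det_submatrix_update {k n : ℕ} {G S : Matrix (Fin n) (Fin n) ℝ} {g : Fin k → Fin n}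
    (hu : IsUnit (G.submatrix g g).det) {C : Matrix (Fin k) (Fin n) ℝ}
    (hCg : C.submatrix id g = 1) (hS : S = G - Cᵀ * G.submatrix g g * C)
    (hSg : ∀ j l, S j (g l) = 0) (hgS : ∀ j l, S (g l) j = 0) (i : Fin k) (j : Fin n) :
    (G.submatrix (Function.update g i j) (Function.update g i j)).det =
      (C i j ^ 2 + S j j * (G.submatrix g g)⁻¹ i i) * (G.submatrix g g).det := by
  set H := G.submatrix g g
  have hU : C.submatrix id (Function.update g i j) =
      (1 : Matrix (Fin k) (Fin k) ℝ).updateCol i (fun a => C a j) := by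
    ext a b
    by_cases hb : b = i
    · subst hb; simp
    · rw [updateCol_ne hb, ← hCg]; simp [hb]
  have hG : G.submatrix (Function.update g i j) (Function.update g i j) =
      (C.submatrix id (Function.update g i j))ᵀ * H * C.submatrix id (Function.update g i j) +
        Matrix.single i i (S j j) := by
    have h1 : G = Cᵀ * H * C + S := by rw [hS]; abel
    conv_lhs => rw [h1]
    have h2 : (Cᵀ * H * C).submatrix (Function.update g i j) (Function.update g i j) =
        (C.submatrix id (Function.update g i j))ᵀ * H * C.submatrix id (Function.update g i j) := by
      ext a b
      simp [Matrix.mul_apply]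
    rw [submatrix_add, Pi.add_apply, Pi.add_apply, h2]
    congr 1
    ext a b
    by_cases ha : a = i
    · subst ha
      by_cases hb : b = a
      · subst hb; simp
      · simp [hb, Ne.symm hb, hSg]
    · simp [ha, Ne.symm ha, hgS]
  rw [hG, hU, det_conj_add_single, inv_def, Ring.inverse_eq_inv', Matrix.smul_apply, smul_eq_mul]
  have := hu.ne_zero
  field_simp

theorem transpose_mulVec_sub_mulVec_eq_zero {κ ι : Type*} [Fintype κ] [Fintype ι] [DecidableEq κ]
    {J : Matrix ι κ ℝ} (hJJ : Jᵀ * J = 1) (x : ι → ℝ) : Jᵀ *ᵥ (x - J *ᵥ (Jᵀ *ᵥ x)) = 0 := by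
  rw [mulVec_sub, mulVec_mulVec _ Jᵀ J, hJJ, one_mulVec, sub_self]

theorem dotProduct_self_eq_add_of_transpose_mul_self {κ ι : Type*} [Fintype κ] [Fintype ι]
    [DecidableEq κ] {J : Matrix ι κ ℝ} (hJJ : Jᵀ * J = 1) (x : ι → ℝ) :
    x ⬝ᵥ x = (x - J *ᵥ (Jᵀ *ᵥ x)) ⬝ᵥ (x - J *ᵥ (Jᵀ *ᵥ x)) + (Jᵀ *ᵥ x) ⬝ᵥ (Jᵀ *ᵥ x) := by
  have h1 : (J *ᵥ (Jᵀ *ᵥ x)) ⬝ᵥ (J *ᵥ (Jᵀ *ᵥ x)) = (Jᵀ *ᵥ x) ⬝ᵥ (Jᵀ *ᵥ x) := by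
    rw [mulVec_dotProduct, mulVec_mulVec, hJJ, one_mulVec]
  have h2 : (J *ᵥ (Jᵀ *ᵥ x)) ⬝ᵥ x = (Jᵀ *ᵥ x) ⬝ᵥ (Jᵀ *ᵥ x) := mulVec_dotProduct _ _ _
  simp only [sub_dotProduct, dotProduct_sub, h1, h2, dotProduct_comm x (J *ᵥ (Jᵀ *ᵥ x))]
  ring

theorem eq_zero_of_transpose_submatrix_mulVec {κ ι : Type*} [Fintype κ] [Fintype ι]
    [DecidableEq ι] {g : κ → ι} {v : ι → ℝ}
    (hv : ((1 : Matrix ι ι ℝ).submatrix id g)ᵀ *ᵥ v = 0) {j : ι}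
    (hj : j ∉ (Finset.univ.image g)ᶜ) : v j = 0 := by
  simp only [Finset.mem_compl, Finset.mem_image, Finset.mem_univ, true_and, not_not] at hj
  obtain ⟨l, rfl⟩ := hj
  have := congrFun hv l
  simpa [mulVec, dotProduct, Matrix.one_apply] using this

theorem card_compl_image_eq_sub {k n : ℕ} (hkn : k ≤ n) {g : Fin k → Fin n}
    (hg : Function.Injective g) : (((Finset.univ.image g)ᶜ).card : ℝ) = (n : ℝ) - k := by
  rw [Finset.card_compl, Finset.card_image_of_injective _ hg, Finset.card_univ,
    Fintype.card_fin, Fintype.card_fin, Nat.cast_sub hkn]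

/-- Interpolation matrix `C`, principal block `H` and Schur complement `S` for a choice of indices
maximizing the principal minor of a positive definite matrix. -/
theorem exists_schur_decomposition {k n : ℕ} (hkn : k ≤ n) {G : Matrix (Fin n) (Fin n) ℝ}
    (hG : G.PosDef) :
    ∃ (g : Fin k → Fin n) (J : Matrix (Fin n) (Fin k) ℝ) (C : Matrix (Fin k) (Fin n) ℝ)
      (H : Matrix (Fin k) (Fin k) ℝ) (S : Matrix (Fin n) (Fin n) ℝ), StrictMono g ∧
      J = (1 : Matrix (Fin n) (Fin n) ℝ).submatrix id g ∧ C * J = 1 ∧ H.PosDef ∧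
      G * J = Cᵀ * H ∧ S = G - Cᵀ * H * C ∧ Jᵀ * S = 0 ∧ S * J = 0 ∧
      S = (1 - J * C)ᵀ * G * (1 - J * C) ∧ ∀ i j, C i j ^ 2 + S j j * H⁻¹ i i ≤ 1 := by
  obtain ⟨g, hg, hmax⟩ := exists_strictMono_det_submatrix_max hkn hG
  obtain ⟨J, hJ⟩ : ∃ J, J = (1 : Matrix (Fin n) (Fin n) ℝ).submatrix id g := ⟨_, rfl⟩
  have hmulJ : ∀ {l : ℕ} (M : Matrix (Fin l) (Fin n) ℝ), M * J = M.submatrix id g := fun M => by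
    ext a b; simp [hJ, Matrix.mul_apply, Matrix.one_apply]
  have hJmul : ∀ {l : ℕ} (M : Matrix (Fin n) (Fin l) ℝ), Jᵀ * M = M.submatrix g id := fun M => by
    ext a b; simp [hJ, Matrix.mul_apply, Matrix.one_apply]
  obtain ⟨H, hHdef⟩ : ∃ H, H = G.submatrix g g := ⟨_, rfl⟩
  have hH : H.PosDef := hHdef ▸ hG.submatrix hg.injective
  have hu : IsUnit H.det := hH.det_pos.ne'.isUnit
  have hGT : Gᵀ = G := by
    have : G.IsSymm := by simpa using hG.1
    exact this
  have hHT : Hᵀ = H := by rw [hHdef, transpose_submatrix, hGT]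
  obtain ⟨C, hC⟩ : ∃ C, C = H⁻¹ * G.submatrix g id := ⟨_, rfl⟩
  have hCg : C.submatrix id g = 1 := by
    rw [← nonsing_inv_mul _ hu, hC, hHdef]; ext a b; simp [Matrix.mul_apply]
  have hCJ : C * J = 1 := by rw [hmulJ, hCg]
  have hHC : H * C = Jᵀ * G := by rw [hJmul, hC, mul_nonsing_inv_cancel_left _ _ hu]
  have hGJ : G * J = Cᵀ * H := by
    rw [← transpose_inj, transpose_mul, transpose_mul, hGT, hHT, transpose_transpose, hHC]
  obtain ⟨S, hS⟩ : ∃ S, S = G - Cᵀ * H * C := ⟨_, rfl⟩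
  have hJC : Jᵀ * Cᵀ = 1 := by rw [← transpose_mul, hCJ, transpose_one]
  have hJS : Jᵀ * S = 0 := by
    rw [hS, Matrix.mul_sub, ← hHC, Matrix.mul_assoc Cᵀ, ← Matrix.mul_assoc Jᵀ Cᵀ, hJC,
      Matrix.one_mul, sub_self]
  have hSJ : S * J = 0 := by
    rw [hS, Matrix.sub_mul, hGJ, Matrix.mul_assoc, hCJ, Matrix.mul_one, sub_self]
  have hGS : G * (1 - J * C) = S := by
    rw [Matrix.mul_sub, Matrix.mul_one, ← Matrix.mul_assoc, hGJ, hS]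
  have hSG : S = (1 - J * C)ᵀ * G * (1 - J * C) := by
    rw [Matrix.mul_assoc, hGS, transpose_sub, transpose_one, transpose_mul, Matrix.sub_mul,
      Matrix.one_mul, Matrix.mul_assoc, hJS, Matrix.mul_zero, sub_zero]
  have hSg : ∀ j l, S j (g l) = 0 := fun j l => by
    have := congrFun (congrFun hSJ j) l
    rwa [hmulJ] at this
  have hgS : ∀ j l, S (g l) j = 0 := fun j l => by
    have := congrFun (congrFun hJS l) j
    rwa [hJmul] at this
  have hle : ∀ i j, C i j ^ 2 + S j j * H⁻¹ i i ≤ 1 := fun i j => by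
    have h := hmax (Function.update g i j)
    rw [det_submatrix_update (hHdef ▸ hu) hCg (hHdef ▸ hS) hSg hgS, ← hHdef] at h
    exact (mul_le_iff_le_one_left hH.det_pos).1 h
  exact ⟨g, J, C, H, S, hg, hJ, hCJ, hH, hGJ, hS, hJS, hSJ, hSG, hle⟩

theorem exists_interpolation_approx {m n k : ℕ} (hk : 0 < k) (hkn : k ≤ n)
    (A : Matrix (Fin m) (Fin n) ℝ) {δ : ℝ} (hδ : 0 < δ) :
    ∃ (g : Fin k → Fin n) (C : Matrix (Fin k) (Fin n) ℝ), StrictMono g ∧ C.submatrix id g = 1 ∧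
      (∀ i j, |C i j| ≤ 1) ∧ ∀ x : Fin n → ℝ,
        ((A - A.submatrix id g * C) *ᵥ x) ⬝ᵥ ((A - A.submatrix id g * C) *ᵥ x) ≤
          ((k : ℝ) * ((n : ℝ) - k) + 1) * (singularValue A (k + 1) ^ 2 + δ) * (x ⬝ᵥ x) := by
  have : Nonempty (Fin k) := ⟨⟨0, hk⟩⟩
  obtain ⟨G, hGdef⟩ : ∃ G : Matrix (Fin n) (Fin n) ℝ, G = Aᵀ * A + δ • 1 := ⟨_, rfl⟩
  have hAA : (Aᵀ * A).PosSemidef := by simpa using posSemidef_conjTranspose_mul_self A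
  have hG : G.PosDef := hGdef ▸ Matrix.PosDef.posSemidef_add hAA (PosDef.one.smul hδ)
  obtain ⟨g, J, C, H, S, hg, hJ, hCJ, hH, hGJ, hS, hJS, hSJ, hSG, hle⟩ :=
    exists_schur_decomposition hkn hG
  have hmulJ : ∀ {l : ℕ} (M : Matrix (Fin l) (Fin n) ℝ), M * J = M.submatrix id g := fun M => by
    ext a b; simp [hJ, Matrix.mul_apply, Matrix.one_apply]
  have hCg : C.submatrix id g = 1 := by rw [← hmulJ, hCJ]
  have hJJ : Jᵀ * J = 1 := by
    ext a b; simp [hJ, Matrix.mul_apply, Matrix.one_apply, hg.injective.eq_iff]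
  have hS0 : S.PosSemidef := by
    have h := hG.posSemidef.conjTranspose_mul_mul_same (1 - J * C)
    rwa [conjTranspose_eq_transpose_of_trivial, ← hSG] at h
  have hSg : ∀ j l, S j (g l) = 0 := fun j l => by
    have := congrFun (congrFun hSJ j) l
    rwa [hmulJ] at this
  refine ⟨g, C, hg, hCg, fun i j => ?_, fun x => ?_⟩
  · have h1 := mul_nonneg (hS0.diag_nonneg (i := j)) (hH.inv.posSemidef.diag_nonneg (i := i))
    exact (sq_le_one_iff_abs_le_one _).1 (by linarith [hle i j])
  set s : Finset (Fin n) := (Finset.univ.image g)ᶜ with hs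
  have hscard : (s.card : ℝ) = (n : ℝ) - k := card_compl_image_eq_sub hkn hg.injective
  set τ := ∑ i, ∑ j ∈ s, C i j ^ 2 with hτ
  have htr : S.trace = ∑ j ∈ s, S j j := by
    refine (Finset.sum_subset (Finset.subset_univ s) fun j _ hj => ?_).symm
    simp only [hs, Finset.mem_compl, Finset.mem_image, Finset.mem_univ, true_and, not_not] at hj
    obtain ⟨l, rfl⟩ := hj
    exact hSg _ _
  set K : ℝ := (k : ℝ) * ((n : ℝ) - k) + 1 with hK
  have hKle : S.trace * H⁻¹.trace + τ + 1 ≤ K := by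
    have h : ∑ i, ∑ j ∈ s, (C i j ^ 2 + S j j * H⁻¹ i i) ≤ ∑ i : Fin k, ∑ j ∈ s, (1 : ℝ) :=
      Finset.sum_le_sum fun i _ => Finset.sum_le_sum fun j _ => hle i j
    simp only [Finset.sum_add_distrib, ← Finset.sum_mul, ← htr, ← Finset.mul_sum,
      Finset.sum_const, nsmul_eq_mul, mul_one, hscard, Finset.card_univ, Fintype.card_fin] at h
    rw [hK, Matrix.trace.eq_def H⁻¹]
    simp only [diag_apply]
    linarith
  have hτ0 : 0 ≤ τ := Finset.sum_nonneg fun i _ => Finset.sum_nonneg fun j _ => sq_nonneg _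
  have hprod : 0 ≤ S.trace * H⁻¹.trace := mul_nonneg hS0.trace_nonneg hH.inv.posSemidef.trace_nonneg
  have hKpos : 0 < K := by linarith
  set v := x - J *ᵥ (Jᵀ *ᵥ x) with hv
  have hJv : Jᵀ *ᵥ v = 0 := transpose_mulVec_sub_mulVec_eq_zero hJJ x
  have hvs : ∀ j, j ∉ s → v j = 0 := fun j hj =>
    eq_zero_of_transpose_submatrix_mulVec (hJ ▸ hJv) hj
  have hxv : v ⬝ᵥ v ≤ x ⬝ᵥ x := by
    rw [dotProduct_self_eq_add_of_transpose_mul_self hJJ x, ← hv]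
    exact le_add_of_nonneg_right (by simpa using dotProduct_star_self_nonneg (Jᵀ *ᵥ x))
  have hvv : 0 ≤ v ⬝ᵥ v := by simpa using dotProduct_star_self_nonneg v
  have hGA : ∀ z, z ⬝ᵥ (G *ᵥ z) = z ⬝ᵥ ((Aᵀ * A) *ᵥ z) + δ * (z ⬝ᵥ z) := fun z => by
    rw [hGdef, add_mulVec, smul_mulVec, one_mulVec, dotProduct_add, dotProduct_smul, smul_eq_mul]
  have hErr : ((A - A.submatrix id g * C) *ᵥ x) ⬝ᵥ ((A - A.submatrix id g * C) *ᵥ x) ≤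
      v ⬝ᵥ (S *ᵥ v) := by
    have h1 : (A - A.submatrix id g * C) *ᵥ x = A *ᵥ ((1 - J * C) *ᵥ v) := by
      have h2 : (1 - J * C) *ᵥ v = (1 - J * C) *ᵥ x := by
        rw [hv, mulVec_sub, mulVec_mulVec _ _ J, Matrix.sub_mul, Matrix.one_mul, Matrix.mul_assoc,
          hCJ, Matrix.mul_one, sub_self, zero_mulVec, sub_zero]
      rw [h2, mulVec_mulVec, Matrix.mul_sub, Matrix.mul_one, ← Matrix.mul_assoc, hmulJ]
    have h3 : v ⬝ᵥ (S *ᵥ v) = ((1 - J * C) *ᵥ v) ⬝ᵥ (G *ᵥ ((1 - J * C) *ᵥ v)) := by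
      rw [hSG, mulVec_dotProduct]
      simp only [mulVec_mulVec, Matrix.mul_assoc]
    rw [h1, h3, hGA, mulVec_dotProduct, mulVec_mulVec]
    have : 0 ≤ ((1 - J * C) *ᵥ v) ⬝ᵥ ((1 - J * C) *ᵥ v) := by
      simpa using dotProduct_star_self_nonneg ((1 - J * C) *ᵥ v)
    nlinarith
  refine hErr.trans (le_trans ?_ (mul_le_mul_of_nonneg_left hxv (by positivity)))
  by_cases hv0 : v = 0
  · simp [hv0]
  have hvpos : 0 < v ⬝ᵥ v := by simpa using dotProduct_star_self_pos_iff.2 hv0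
  have hkn' : k + 1 ≤ n := by
    by_contra hlt
    have hs0 : s = ∅ := by
      rw [← Finset.card_eq_zero]
      have : (n : ℝ) = k := by exact_mod_cast (show n = k by omega)
      rw [this, sub_self] at hscard
      exact_mod_cast hscard
    exact hv0 (funext fun j => hvs j (by simp [hs0]))
  let φ : ((Fin k → ℝ) × ℝ) →ₗ[ℝ] (Fin n → ℝ) :=
    J.mulVecLin.coprod (LinearMap.toSpanSingleton ℝ _ v)
  have hφ : ∀ y, φ y = J *ᵥ y.1 + y.2 • v := fun y => by simp [φ]
  have hφinj : Function.Injective φ := by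
    rw [← LinearMap.ker_eq_bot, LinearMap.ker_eq_bot']
    intro y hy
    rw [hφ] at hy
    have h1 : y.1 = 0 := by
      have := congrArg (Jᵀ *ᵥ ·) hy
      simpa only [mulVec_add, mulVec_mulVec, hJJ, one_mulVec, mulVec_smul, hJv, smul_zero,
        add_zero, mulVec_zero] using this
    have h2 : y.2 = 0 := by
      rw [h1, mulVec_zero, zero_add, smul_eq_zero] at hy
      exact hy.resolve_right hv0
    exact Prod.ext h1 h2
  have hKv : 0 < K * (v ⬝ᵥ v) := mul_pos hKpos hvpos
  have hmain := le_ithLargestEig hAA.1 (Nat.le_add_left 1 k) hkn' (by simp) φ hφinj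
    (v ⬝ᵥ (S *ᵥ v) / (K * (v ⬝ᵥ v)) - δ) fun y => by
      have h := schur_energy_le hH hJJ hCJ hGJ hS hJS hS0 hJv
        (mulVec_dotProduct_self_le C s v hvs) hτ0 y.1 y.2
      rw [← hφ] at h
      have hpos : 0 ≤ φ y ⬝ᵥ (G *ᵥ φ y) := by
        simpa using hG.posSemidef.dotProduct_mulVec_nonneg (φ y)
      have h' := h.trans (mul_le_mul_of_nonneg_right
        (mul_le_mul_of_nonneg_right hKle hvpos.le) hpos)
      rw [hGA] at h'
      rw [sub_mul, div_mul_eq_mul_div, sub_le_iff_le_add, div_le_iff₀ hKv]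
      linarith
  have hσ : ithLargestEig (Aᵀ * A) (k + 1) ≤ singularValue A (k + 1) ^ 2 := by
    rw [singularValue, Real.sq_sqrt']
    exact le_max_left _ _
  have h := hmain.trans hσ
  rw [sub_le_iff_le_add, div_le_iff₀ hKv] at h
  linarith

theorem exists_interpolation {m n k : ℕ} (hk : 0 < k) (hkn : k ≤ n)
    (A : Matrix (Fin m) (Fin n) ℝ) :
    ∃ (g : Fin k → Fin n) (C : Matrix (Fin k) (Fin n) ℝ), StrictMono g ∧ C.submatrix id g = 1 ∧
      (∀ i j, |C i j| ≤ 1) ∧ ∀ x : Fin n → ℝ,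
        ((A - A.submatrix id g * C) *ᵥ x) ⬝ᵥ ((A - A.submatrix id g * C) *ᵥ x) ≤
          ((k : ℝ) * ((n : ℝ) - k) + 1) * singularValue A (k + 1) ^ 2 * (x ⬝ᵥ x) := by
  choose g C hg hCg hC hx using fun N : ℕ =>
    exists_interpolation_approx hk hkn A (Nat.one_div_pos_of_nat (α := ℝ) (n := N))
  have hcpt : IsCompact ((Set.univ : Set (Fin k → Fin n)) ×ˢ
      (Set.univ.pi fun _ => Set.univ.pi fun _ => Set.Icc (-1) 1 : Set (Fin k → Fin n → ℝ))) :=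
    isCompact_univ.prod (isCompact_univ_pi fun _ => isCompact_univ_pi fun _ => isCompact_Icc)
  obtain ⟨⟨g', C'⟩, hmem, φ, hφ, hlim⟩ := hcpt.tendsto_subseq
    (x := fun N => ((g N, C N) : (Fin k → Fin n) × (Fin k → Fin n → ℝ)))
    fun N => ⟨Set.mem_univ _, fun i _ j _ => abs_le.1 (hC N i j)⟩
  rw [nhds_prod_eq] at hlim
  have hlimg : ∀ᶠ N in Filter.atTop, g (φ N) = g' := by
    have h := Filter.tendsto_fst.comp hlim
    rw [nhds_discrete, Filter.tendsto_pure] at h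
    exact h
  have hlimC : Filter.Tendsto (fun N => C (φ N)) Filter.atTop (nhds C') :=
    Filter.tendsto_snd.comp hlim
  obtain ⟨N₀, hN₀⟩ := hlimg.exists
  refine ⟨g', C', hN₀ ▸ hg _, ?_, fun i j => abs_le.2 (hmem.2 i trivial j trivial), fun x => ?_⟩
  · have h : Filter.Tendsto (fun N => (C (φ N)).submatrix id g') Filter.atTop
        (nhds (Matrix.submatrix C' id g')) :=
      ((continuous_id.matrix_submatrix id g').tendsto C').comp hlimC
    refine tendsto_nhds_unique_of_eventuallyEq h tendsto_const_nhds ?_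
    filter_upwards [hlimg] with N hN
    rw [← hN, hCg]
  · have hcont : Continuous fun D : Matrix (Fin k) (Fin n) ℝ =>
        ((A - A.submatrix id g' * D) *ᵥ x) ⬝ᵥ ((A - A.submatrix id g' * D) *ᵥ x) := by
      fun_prop
    have hδ : Filter.Tendsto (fun N => ((k : ℝ) * ((n : ℝ) - k) + 1) *
        (singularValue A (k + 1) ^ 2 + 1 / ((φ N : ℝ) + 1)) * (x ⬝ᵥ x)) Filter.atTop
        (nhds (((k : ℝ) * ((n : ℝ) - k) + 1) * (singularValue A (k + 1) ^ 2 + 0) * (x ⬝ᵥ x))) :=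
      (((tendsto_one_div_add_atTop_nhds_zero_nat (𝕜 := ℝ)).comp hφ.tendsto_atTop).const_add
        _).const_mul _ |>.mul_const _
    rw [add_zero] at hδ
    refine le_of_tendsto_of_tendsto ((hcont.tendsto C').comp hlimC) hδ ?_
    filter_upwards [hlimg] with N hN
    rw [← hN]
    exact hx (φ N) x

theorem specNorm_le_of_dotProduct_le {m n : Type*} [Fintype m] [Fintype n] [DecidableEq n]
    {M : Matrix m n ℝ} {c : ℝ} (hc : 0 ≤ c)
    (h : ∀ x, (M *ᵥ x) ⬝ᵥ (M *ᵥ x) ≤ c ^ 2 * (x ⬝ᵥ x)) : specNorm M ≤ c := by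
  refine ContinuousLinearMap.opNorm_le_bound _ hc fun x => ?_
  refine le_of_sq_le_sq ?_ (by positivity)
  rw [mul_pow, EuclideanSpace.real_norm_sq_eq, EuclideanSpace.real_norm_sq_eq]
  simpa [dotProduct, sq] using h x.ofLp

/-- Existence of a rank-`k` column interpolative decomposition with the properties of
Lemma 3.1 of Martinsson–Rokhlin–Tygert. -/
theorem stmt0 (m n k : ℕ) (hm : 0 < m) (hn : 0 < n) (hk : 0 < k)
    (hkmn : k ≤ min m n) (A : Matrix (Fin m) (Fin n) ℝ) :
    ∃ (I : Finset (Fin n)) (hI : I.card = k) (C : Matrix (Fin k) (Fin n) ℝ),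
      -- (1) the columns of `C` indexed by `I` form the identity matrix
      colSub C I hI = (1 : Matrix (Fin k) (Fin k) ℝ) ∧
      -- (2) no entry of `C` has absolute value greater than 1
      (∀ i j, |C i j| ≤ 1) ∧
      -- (3) spectral norm bound
      specNorm C ≤ Real.sqrt ((k : ℝ) * ((n : ℝ) - (k : ℝ)) + 1) ∧
      -- (4) the k-th largest singular value of `C` is at least one
      1 ≤ singularValue C k ∧
      -- (5) exactness when `k = m` or `k = n`
      ((k = m ∨ k = n) → A = colSub A I hI * C) ∧
      -- (6) spectral-norm error bound
      specNorm (A - colSub A I hI * C) ≤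
        Real.sqrt ((k : ℝ) * ((n : ℝ) - (k : ℝ)) + 1) * singularValue A (k + 1) := by
  have hkn : k ≤ n := hkmn.trans (min_le_right _ _)
  obtain ⟨g, C, hg, hCg, hC, hx⟩ := exists_interpolation hk hkn A
  have hI : (Finset.univ.image g).card = k := by
    rw [Finset.card_image_of_injective _ hg.injective, Finset.card_univ, Fintype.card_fin]
  have hsub : ∀ {l : ℕ} (M : Matrix (Fin l) (Fin n) ℝ),
      colSub M (Finset.univ.image g) hI = M.submatrix id g := fun M => by
    have h : g = (Finset.univ.image g).orderEmbOfFin hI :=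
      Finset.orderEmbOfFin_unique hI (fun l => Finset.mem_image_of_mem g (Finset.mem_univ l)) hg
    ext a b
    rw [colSub, submatrix_apply, submatrix_apply, Finset.coe_orderIsoOfFin_apply, ← h]
  have hkn0 : (0 : ℝ) ≤ (k : ℝ) * ((n : ℝ) - k) :=
    mul_nonneg k.cast_nonneg (sub_nonneg.2 (Nat.cast_le.2 hkn))
  set J : Matrix (Fin n) (Fin k) ℝ := (1 : Matrix (Fin n) (Fin n) ℝ).submatrix id g with hJ
  have hCJ : C * J = 1 := by
    rw [← hCg]; ext a b; simp [hJ, Matrix.mul_apply, Matrix.one_apply]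
  have hJJ : Jᵀ * J = 1 := by
    ext a b; simp [hJ, Matrix.mul_apply, Matrix.one_apply, hg.injective.eq_iff]
  refine ⟨Finset.univ.image g, hI, C, (hsub C).trans hCg, hC, ?_, ?_, fun hkmn' => ?_, ?_⟩
  · refine specNorm_le_of_dotProduct_le (Real.sqrt_nonneg _) fun x => ?_
    rw [Real.sq_sqrt (by linarith), dotProduct_self_eq_add_of_transpose_mul_self hJJ x]
    have hJv := transpose_mulVec_sub_mulVec_eq_zero hJJ x
    set v := x - J *ᵥ (Jᵀ *ᵥ x) with hv
    have hvv : 0 ≤ v ⬝ᵥ v := by simpa using dotProduct_star_self_nonneg v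
    have hCv := mulVec_dotProduct_self_le C _ v
      fun j hj => eq_zero_of_transpose_submatrix_mulVec hJv hj
    have hτ : ∑ i, ∑ j ∈ (Finset.univ.image g)ᶜ, C i j ^ 2 ≤ (k : ℝ) * ((n : ℝ) - k) := by
      calc _ ≤ ∑ i : Fin k, ∑ j ∈ (Finset.univ.image g)ᶜ, (1 : ℝ) :=
            Finset.sum_le_sum fun i _ => Finset.sum_le_sum fun j _ =>
              (sq_le_one_iff_abs_le_one _).2 (hC i j)
        _ = _ := by simp [← card_compl_image_eq_sub hkn hg.injective]
    have hCx : C *ᵥ x = C *ᵥ v + Jᵀ *ᵥ x := by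
      rw [hv, mulVec_sub, mulVec_mulVec _ C J, hCJ, one_mulVec, sub_add_cancel]
    have h := dotProduct_self_add_le (q := C *ᵥ v) (r := Jᵀ *ᵥ x) zero_le_one hkn0 zero_le_one hvv
      (by simpa using dotProduct_star_self_nonneg (Jᵀ *ᵥ x))
      ((one_mul _).trans_le (hCv.trans (mul_le_mul_of_nonneg_right hτ hvv))) le_rfl
    rwa [one_mul, ← hCx] at h
  · rw [singularValue, Real.one_le_sqrt]
    have hCC : (Cᵀ * C).PosSemidef := by simpa using posSemidef_conjTranspose_mul_self C
    refine le_ithLargestEig hCC.1 hk hkn (by simp) J.mulVecLin (fun y z hyz => ?_) 1 fun y => ?_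
    · have := congrArg (C *ᵥ ·) hyz
      simpa only [mulVecLin_apply, mulVec_mulVec, hCJ, one_mulVec] using this
    · simp only [mulVecLin_apply, one_mul]
      rw [← mulVec_mulVec, ← mulVec_dotProduct, mulVec_mulVec, hCJ, one_mulVec, mulVec_dotProduct,
        mulVec_mulVec, hJJ, one_mulVec]
  · have hσ : singularValue A (k + 1) = 0 := by
      rw [singularValue, Real.sqrt_eq_zero']
      rcases hkmn' with h | h
      · exact (ithLargestEig_transpose_mul_self_eq_zero A (by omega)).le
      · rw [ithLargestEig]
        split_ifs
        · omega
        · exact le_rfl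
        · exact le_rfl
    rw [hsub, ← sub_eq_zero]
    refine Matrix.ext_of_mulVec_single fun j => ?_
    rw [zero_mulVec, ← dotProduct_self_eq_zero]
    refine le_antisymm ((hx _).trans_eq (by simp [hσ])) ?_
    simpa using dotProduct_star_self_nonneg
      ((A - A.submatrix id g * C) *ᵥ (Pi.single j 1 : Fin n → ℝ))
  · rw [hsub]
    refine specNorm_le_of_dotProduct_le
      (mul_nonneg (Real.sqrt_nonneg _) (Real.sqrt_nonneg _)) fun x => ?_
    rw [mul_pow, Real.sq_sqrt (by linarith)]
    exact hx x
end

section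
/- Let C be a real k × n matrix (k ≤ n) such that there is a set I ⊆ {0, …, n−1} with |I| = k for which the k × k submatrix of C formed by the columns indexed by I is the identity matrix, and such that every entry of C has absolute value at most 1. Then the spectral norm of C satisfies ‖C‖₂ ≤ √(k(n−k) + 1). -/
open Matrix

theorem specNorm_eq_specNorm_transpose {m n : Type*} [Fintype m] [Fintype n] [DecidableEq m]
    [DecidableEq n] (A : Matrix m n ℝ) : specNorm A = specNorm Aᵀ := by
  open scoped Matrix.Norms.L2Operator in
  have h := Matrix.l2_opNorm_conjTranspose A
  rw [Matrix.conjTranspose_eq_transpose_of_trivial] at h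
  exact h.symm

theorem sq_sum_mul_le_card_mul_sum_sq {ι : Type*} [Fintype ι] (c y : ι → ℝ)
    (hc : ∀ i, |c i| ≤ 1) : (∑ i, c i * y i) ^ 2 ≤ Fintype.card ι * ∑ i, y i ^ 2 := by
  refine (Finset.sum_mul_sq_le_sq_mul_sq _ _ _).trans ?_
  gcongr
  calc ∑ i, c i ^ 2 ≤ ∑ _i : ι, (1 : ℝ) :=
        Finset.sum_le_sum fun i _ => (sq_le_one_iff_abs_le_one _).mpr (hc i)
    _ = Fintype.card ι := by simp

theorem sum_sq_of_colSub_eq_one {k n : ℕ} (C : Matrix (Fin k) (Fin n) ℝ)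
    (I : Finset (Fin n)) (hI : I.card = k) (hid : colSub C I hI = 1) (y : Fin k → ℝ) :
    ∑ j ∈ I, (∑ i, C i j * y i) ^ 2 = ∑ i, y i ^ 2 := by
  have hentry (i a : Fin k) :
      C i (I.orderIsoOfFin hI a) = (1 : Matrix (Fin k) (Fin k) ℝ) i a := by
    rw [← hid]; rfl
  rw [← Finset.sum_coe_sort I, ← (I.orderIsoOfFin hI).toEquiv.sum_comp]
  refine Finset.sum_congr rfl fun a _ => ?_
  simp only [RelIso.coe_fn_toEquiv, hentry]
  simp [Matrix.one_apply]

/-- If the columns of `C` indexed by `I` form the identity matrix and every entry of `C` has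
absolute value at most 1, then `‖C‖₂ ≤ √(k(n−k) + 1)`. -/
theorem stmt1 (k n : ℕ) (hkn : k ≤ n) (C : Matrix (Fin k) (Fin n) ℝ)
    (I : Finset (Fin n)) (hI : I.card = k)
    (hid : colSub C I hI = (1 : Matrix (Fin k) (Fin k) ℝ))
    (hent : ∀ i j, |C i j| ≤ 1) :
    specNorm C ≤ Real.sqrt ((k : ℝ) * ((n : ℝ) - (k : ℝ)) + 1) := by
  rw [specNorm_eq_specNorm_transpose]
  refine ContinuousLinearMap.opNorm_le_bound _ (Real.sqrt_nonneg _) fun y => ?_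
  have hnk : (0 : ℝ) ≤ (n : ℝ) - k := sub_nonneg.mpr (by exact_mod_cast hkn)
  refine (sq_le_sq₀ (norm_nonneg _) (by positivity)).mp ?_
  rw [mul_pow, Real.sq_sqrt (by positivity), EuclideanSpace.real_norm_sq_eq,
    EuclideanSpace.real_norm_sq_eq]
  have happly (j : Fin n) :
      (Matrix.toEuclideanLin Cᵀ).toContinuousLinearMap y j = ∑ i, C i j * y i := by
    simp [Matrix.mulVec, dotProduct]
  simp only [happly]
  rw [← Finset.sum_add_sum_compl I, sum_sq_of_colSub_eq_one C I hI hid]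
  have hcompl : ∑ j ∈ Iᶜ, (∑ i, C i j * y i) ^ 2 ≤ ((n : ℝ) - k) * (k * ∑ i, y i ^ 2) := by
    have hcard : ((Iᶜ).card : ℝ) = (n : ℝ) - k := by
      rw [Finset.card_compl, hI, Fintype.card_fin, Nat.cast_sub hkn]
    rw [← hcard, ← nsmul_eq_mul]
    refine Finset.sum_le_card_nsmul _ _ _ fun j _ => ?_
    simpa using sq_sum_mul_le_card_mul_sum_sq (fun i => C i j) y fun i => hent i j
  linarith
end

section
/- (SubID error bound.) Let A be a real m × n matrix, let J ⊆ {0, …, m−1} be a set of row indices, and let B = A(J,:) be the corresponding row-subsampled matrix. Fix a positive integer k with k ≤ rank(B), a set I ⊆ {0, …, n−1} with |I| = k, and a real k × n matrix C, and set B̂ = B(:,I) C and Â = A(:,I) C. Let σ_k and σ_{k+1} denote the k-th and (k+1)-th largest singular values of B (so σ_k > 0). For τ ≥ 0, define ε(τ) = λ_max(A Aᵀ − τ B Bᵀ), the largest eigenvalue of the real symmetric matrix A Aᵀ − τ B Bᵀ, and assume ε(τ) ≥ 0. Then ‖A − Â‖₂ ≤ (1 + ‖C‖₂) √(τ σ_{k+1}²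 + ε(τ)) + ‖B − B̂‖₂ √(τ + ε(τ) σ_k^{−2}). -/
open Matrix

/-- The submatrix of `A` formed by the rows indexed by the set `J`, in increasing order. -/
noncomputable def rowSub {m n : ℕ} (A : Matrix (Fin m) (Fin n) ℝ) (J : Finset (Fin m)) :
    Matrix (Fin J.card) (Fin n) ℝ :=
  A.submatrix (fun i => ((J.orderIsoOfFin rfl i : Fin m))) id

theorem ithLargestEig_eq {n : ℕ} {S : Matrix (Fin n) (Fin n) ℝ} (hS : S.IsHermitian) {i : ℕ}
    (h1 : 1 ≤ i) (hn : i ≤ n) :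
    ithLargestEig S i = hS.eigenvalues (Tuple.sort hS.eigenvalues ⟨n - i, by omega⟩) := by
  rw [ithLargestEig, dif_pos hS, dif_pos ⟨h1, hn⟩]

theorem eigenvalues_le_ithLargestEig_of_symm_le {n : ℕ} {S : Matrix (Fin n) (Fin n) ℝ}
    (hS : S.IsHermitian) {i : ℕ} (h1 : 1 ≤ i) (hn : i ≤ n) {j : Fin n}
    (hj : ((Tuple.sort hS.eigenvalues).symm j : ℕ) ≤ n - i) :
    hS.eigenvalues j ≤ ithLargestEig S i := by
  rw [ithLargestEig_eq hS h1 hn]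
  have h := Tuple.monotone_sort hS.eigenvalues
    (show (Tuple.sort hS.eigenvalues).symm j ≤ ⟨n - i, by omega⟩ from hj)
  simpa using h

theorem ithLargestEig_le_eigenvalues_of_le_symm {n : ℕ} {S : Matrix (Fin n) (Fin n) ℝ}
    (hS : S.IsHermitian) {i : ℕ} (h1 : 1 ≤ i) (hn : i ≤ n) {j : Fin n}
    (hj : n - i ≤ ((Tuple.sort hS.eigenvalues).symm j : ℕ)) :
    ithLargestEig S i ≤ hS.eigenvalues j := by
  rw [ithLargestEig_eq hS h1 hn]
  have h := Tuple.monotone_sort hS.eigenvalues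
    (show ⟨n - i, by omega⟩ ≤ (Tuple.sort hS.eigenvalues).symm j from hj)
  simpa using h

theorem isHermitian_transpose_mul_self_real {m n : Type*} [Fintype m] (A : Matrix m n ℝ) :
    (Aᵀ * A).IsHermitian :=
  isHermitian_conjTranspose_mul_self A

theorem posSemidef_transpose_mul_self_real {m n : Type*} [Fintype m] [Finite n]
    (A : Matrix m n ℝ) : (Aᵀ * A).PosSemidef :=
  posSemidef_conjTranspose_mul_self A

theorem ithLargestEig_transpose_mul_self_nonneg {m n : ℕ} (A : Matrix (Fin m) (Fin n) ℝ) (i : ℕ) :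
    0 ≤ ithLargestEig (Aᵀ * A) i := by
  rw [ithLargestEig]
  split_ifs
  · exact (posSemidef_transpose_mul_self_real A).eigenvalues_nonneg _
  · rfl
  · rfl

theorem singularValue_sq {m n : ℕ} (A : Matrix (Fin m) (Fin n) ℝ) (i : ℕ) :
    singularValue A i ^ 2 = ithLargestEig (Aᵀ * A) i :=
  Real.sq_sqrt (ithLargestEig_transpose_mul_self_nonneg A i)

/-- The `k`-th largest eigenvalue of the Gram matrix of a matrix of rank at least `k` is
positive. -/
theorem ithLargestEig_transpose_mul_self_pos {m n k : ℕ} (A : Matrix (Fin m) (Fin n) ℝ)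
    (hk : 0 < k) (hrank : k ≤ A.rank) : 0 < ithLargestEig (Aᵀ * A) k := by
  have hkn : k ≤ n := hrank.trans (by simpa using A.rank_le_width)
  have hS := isHermitian_transpose_mul_self_real A
  refine (ithLargestEig_transpose_mul_self_nonneg A k).lt_of_ne' fun h0 => ?_
  rw [← rank_transpose_mul_self, hS.rank_eq_card_non_zero_eigs, Fintype.card_subtype] at hrank
  have hsub : (Finset.univ.filter fun i => hS.eigenvalues i ≠ 0) ⊆
      (Finset.Ioi (⟨n - k, by omega⟩ : Fin n)).image (Tuple.sort hS.eigenvalues) := by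
    intro i hi
    refine Finset.mem_image.2 ⟨(Tuple.sort hS.eigenvalues).symm i, ?_, by simp⟩
    by_contra hlt
    rw [Finset.mem_Ioi, not_lt] at hlt
    have hle := eigenvalues_le_ithLargestEig_of_symm_le hS hk hkn (Fin.le_def.1 hlt)
    exact (Finset.mem_filter.1 hi).2 (le_antisymm (h0 ▸ hle)
      ((posSemidef_transpose_mul_self_real A).eigenvalues_nonneg i))
  have hcard := (Finset.card_le_card hsub).trans Finset.card_image_le
  rw [Fin.card_Ioi] at hcard
  simp only at hcard
  omega

theorem inner_toEuclideanLin_eq_sum {n : Type*} [Fintype n] [DecidableEq n] {S : Matrix n n ℝ}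
    (hS : S.IsHermitian) (y : EuclideanSpace ℝ n) :
    inner ℝ y (toEuclideanLin S y) =
      ∑ i, hS.eigenvalues i * inner ℝ (hS.eigenvectorBasis i) y ^ 2 := by
  rw [← hS.eigenvectorBasis.sum_inner_mul_inner]
  refine Finset.sum_congr rfl fun i _ => ?_
  have hv : toEuclideanLin S (hS.eigenvectorBasis i) =
      hS.eigenvalues i • hS.eigenvectorBasis i := by
    rw [toLpLin_apply, hS.mulVec_eigenvectorBasis]
    rfl
  rw [← (isSymmetric_toEuclideanLin_iff.2 hS) (hS.eigenvectorBasis i) y, hv, inner_smul_left,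
    real_inner_comm y]
  simp only [conj_trivial]
  ring

theorem inner_toEuclideanLin_transpose_mul_self {m n : Type*} [Fintype m] [Fintype n]
    [DecidableEq n] (A : Matrix m n ℝ) (y : EuclideanSpace ℝ n) :
    inner ℝ y (toEuclideanLin (Aᵀ * A) y) = ‖toEuclideanLin A y‖ ^ 2 := by
  classical
  have hadj : toEuclideanLin Aᵀ = (toEuclideanLin A).adjoint :=
    toEuclideanLin_conjTranspose_eq_adjoint A
  rw [toLpLin_mul_same, LinearMap.comp_apply, hadj, LinearMap.adjoint_inner_right,
    real_inner_self_eq_norm_sq]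

theorem sum_sq_inner_eigenvectorBasis {n : Type*} [Fintype n] [DecidableEq n] {S : Matrix n n ℝ}
    (hS : S.IsHermitian) (y : EuclideanSpace ℝ n) :
    ∑ i, inner ℝ (hS.eigenvectorBasis i) y ^ 2 = ‖y‖ ^ 2 := by
  simpa using hS.eigenvectorBasis.sum_sq_norm_inner_right y

theorem inner_toEuclideanLin_le {n : ℕ} {S : Matrix (Fin n) (Fin n) ℝ} (hS : S.IsHermitian)
    (y : EuclideanSpace ℝ (Fin n)) :
    inner ℝ y (toEuclideanLin S y) ≤ ithLargestEig S 1 * ‖y‖ ^ 2 := by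
  rw [inner_toEuclideanLin_eq_sum hS, ← sum_sq_inner_eigenvectorBasis hS, Finset.mul_sum]
  refine Finset.sum_le_sum fun i _ => mul_le_mul_of_nonneg_right ?_ (sq_nonneg _)
  have hi := i.isLt
  have hlt := ((Tuple.sort hS.eigenvalues).symm i).isLt
  exact eigenvalues_le_ithLargestEig_of_symm_le hS le_rfl (by omega) (by omega)

theorem norm_sq_toEuclideanLin_le_of_gram_sub {m p n : ℕ} (A : Matrix (Fin m) (Fin n) ℝ)
    (B : Matrix (Fin p) (Fin n) ℝ) (τ : ℝ) (y : EuclideanSpace ℝ (Fin n)) :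
    ‖toEuclideanLin A y‖ ^ 2 ≤ τ * ‖toEuclideanLin B y‖ ^ 2 +
      ithLargestEig (Aᵀ * A - τ • (Bᵀ * B)) 1 * ‖y‖ ^ 2 := by
  have hS : (Aᵀ * A - τ • (Bᵀ * B)).IsHermitian :=
    (isHermitian_transpose_mul_self_real A).sub
      ((isHermitian_transpose_mul_self_real B).smul (IsSelfAdjoint.all τ))
  have h := inner_toEuclideanLin_le hS y
  rw [map_sub, map_smul, LinearMap.sub_apply, LinearMap.smul_apply, inner_sub_right,
    inner_smul_right, inner_toEuclideanLin_transpose_mul_self,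
    inner_toEuclideanLin_transpose_mul_self] at h
  linarith

/-- Splitting a vector into its components along the leading `k` right singular vectors of `B`
and along the remaining ones. -/
theorem exists_add_eq_of_singularValue {m n k : ℕ} (B : Matrix (Fin m) (Fin n) ℝ) (hk : 0 < k)
    (hkn : k ≤ n) (y : EuclideanSpace ℝ (Fin n)) :
    ∃ u w : EuclideanSpace ℝ (Fin n), u + w = y ∧ ‖w‖ ^ 2 ≤ ‖y‖ ^ 2 ∧
      ‖toEuclideanLin B u‖ ^ 2 ≤ ‖toEuclideanLin B y‖ ^ 2 ∧
      singularValue B k ^ 2 * ‖u‖ ^ 2 ≤ ‖toEuclideanLin B u‖ ^ 2 ∧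
      ‖toEuclideanLin B w‖ ^ 2 ≤ singularValue B (k + 1) ^ 2 * ‖w‖ ^ 2 := by
  have hS := isHermitian_transpose_mul_self_real B
  have hpos := (posSemidef_transpose_mul_self_real B).eigenvalues_nonneg
  let b := hS.eigenvectorBasis
  let p : Fin n → Prop := fun i => n - k ≤ ((Tuple.sort hS.eigenvalues).symm i : ℕ)
  let u : EuclideanSpace ℝ (Fin n) :=
    b.repr.symm (WithLp.toLp 2 fun i => if p i then inner ℝ (b i) y else 0)
  have hu : ∀ i, inner ℝ (b i) u = if p i then inner ℝ (b i) y else 0 := fun i => by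
    rw [← b.repr_apply_apply, LinearIsometryEquiv.apply_symm_apply]
  have hw : ∀ i, inner ℝ (b i) (y - u) = if p i then 0 else inner ℝ (b i) y := fun i => by
    rw [inner_sub_right, hu]
    split_ifs <;> simp
  refine ⟨u, y - u, by abel, ?_, ?_, ?_, ?_⟩ <;>
    simp only [singularValue_sq, ← inner_toEuclideanLin_transpose_mul_self,
      inner_toEuclideanLin_eq_sum hS, ← sum_sq_inner_eigenvectorBasis hS, Finset.mul_sum] <;>
    refine Finset.sum_le_sum fun i _ => ?_
  · change inner ℝ (b i) (y - u) ^ 2 ≤ inner ℝ (b i) y ^ 2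
    rw [hw]
    split_ifs
    · simpa using sq_nonneg _
    · rfl
  · change _ * inner ℝ (b i) u ^ 2 ≤ _ * inner ℝ (b i) y ^ 2
    rw [hu]
    refine mul_le_mul_of_nonneg_left ?_ (hpos i)
    split_ifs
    · rfl
    · simpa using sq_nonneg _
  · change _ * inner ℝ (b i) u ^ 2 ≤ _ * inner ℝ (b i) u ^ 2
    rw [hu]
    split_ifs with hp
    · exact mul_le_mul_of_nonneg_right
        (ithLargestEig_le_eigenvalues_of_le_symm hS hk hkn hp) (sq_nonneg _)
    · simp
  · change _ * inner ℝ (b i) (y - u) ^ 2 ≤ _ * inner ℝ (b i) (y - u) ^ 2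
    rw [hw]
    split_ifs with hp
    · simp
    · have hp' := not_le.1 hp
      exact mul_le_mul_of_nonneg_right
        (eigenvalues_le_ithLargestEig_of_symm_le hS (by omega) (by omega) (by omega))
        (sq_nonneg _)

theorem norm_toEuclideanLin_le_specNorm {m n : Type*} [Fintype m] [Fintype n] [DecidableEq n]
    (A : Matrix m n ℝ) (x : EuclideanSpace ℝ n) :
    ‖toEuclideanLin A x‖ ≤ specNorm A * ‖x‖ :=
  (toEuclideanLin A).toContinuousLinearMap.le_opNorm x

theorem specNorm_nonneg {m n : Type*} [Fintype m] [Fintype n] [DecidableEq n]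
    (A : Matrix m n ℝ) : 0 ≤ specNorm A :=
  norm_nonneg _

theorem colSub_eq_mul {m n k : ℕ} (A : Matrix (Fin m) (Fin n) ℝ) (I : Finset (Fin n))
    (hI : I.card = k) :
    colSub A I hI = A * colSub (1 : Matrix (Fin n) (Fin n) ℝ) I hI := by
  ext i j
  simp [colSub, mul_apply, one_apply]

theorem norm_toEuclideanLin_colSub_one {n k : ℕ} (I : Finset (Fin n)) (hI : I.card = k)
    (z : EuclideanSpace ℝ (Fin k)) :
    ‖toEuclideanLin (colSub (1 : Matrix (Fin n) (Fin n) ℝ) I hI) z‖ = ‖z‖ := by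
  have h : (colSub (1 : Matrix (Fin n) (Fin n) ℝ) I hI)ᵀ *
      colSub (1 : Matrix (Fin n) (Fin n) ℝ) I hI = 1 := by
    ext i j
    simp [colSub, mul_apply, one_apply, eq_comm]
  rw [← sq_eq_sq₀ (norm_nonneg _) (norm_nonneg _), ← inner_toEuclideanLin_transpose_mul_self, h,
    toLpLin_one, LinearMap.id_apply, real_inner_self_eq_norm_sq]

/-- The residual of an interpolative decomposition factors through `x ↦ x - S C x`, where `S`
selects the columns in `I`. -/
theorem toEuclideanLin_sub_colSub_mul {m n k : ℕ} (A : Matrix (Fin m) (Fin n) ℝ)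
    (I : Finset (Fin n)) (hI : I.card = k) (C : Matrix (Fin k) (Fin n) ℝ)
    (x : EuclideanSpace ℝ (Fin n)) :
    toEuclideanLin (A - colSub A I hI * C) x =
      toEuclideanLin A
        (x - toEuclideanLin (colSub (1 : Matrix (Fin n) (Fin n) ℝ) I hI) (toEuclideanLin C x)) := by
  rw [colSub_eq_mul A, map_sub, map_sub, toLpLin_mul_same, toLpLin_mul_same]
  rfl

theorem le_sqrt_mul_of_sq_le {a b c : ℝ} (hb : 0 ≤ b) (h : a ^ 2 ≤ c * b ^ 2) :
    a ≤ √c * b := by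
  refine (Real.le_sqrt_of_sq_le h).trans_eq ?_
  rw [Real.sqrt_mul' _ (sq_nonneg b), Real.sqrt_sq hb]

/-- SubID error bound (Theorem 1 of Dunton–Jofre–Doostan).  Here
`ε(τ) = λ_max(AᵀA − τ BᵀB)` is the largest eigenvalue of the (dimension-consistent)
Gram-matrix difference over the shared column dimension `n`, with `A` of size `m × n` and
`B = A(J,:)` of size `|J| × n`. -/
theorem stmt4 (m n k : ℕ) (hk : 0 < k)
    (A : Matrix (Fin m) (Fin n) ℝ) (J : Finset (Fin m))
    (B : Matrix (Fin J.card) (Fin n) ℝ) (hB : B = rowSub A J)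
    (hrank : k ≤ B.rank)
    (I : Finset (Fin n)) (hI : I.card = k) (C : Matrix (Fin k) (Fin n) ℝ)
    (Bhat : Matrix (Fin J.card) (Fin n) ℝ) (hBhat : Bhat = colSub B I hI * C)
    (Ahat : Matrix (Fin m) (Fin n) ℝ) (hAhat : Ahat = colSub A I hI * C)
    (τ : ℝ) (hτ : 0 ≤ τ)
    (ε : ℝ) (hε : ε = ithLargestEig (Aᵀ * A - τ • (Bᵀ * B)) 1) (hε0 : 0 ≤ ε) :
    specNorm (A - Ahat) ≤
      (1 + specNorm C) * Real.sqrt (τ * singularValue B (k + 1) ^ 2 + ε) +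
      specNorm (B - Bhat) * Real.sqrt (τ + ε * ((singularValue B k)⁻¹) ^ 2) := by
  have hkn : k ≤ n := hrank.trans (by simpa using B.rank_le_width)
  have hA := norm_sq_toEuclideanLin_le_of_gram_sub A B τ
  rw [← hε] at hA
  have hσ : 0 < singularValue B k ^ 2 :=
    (singularValue_sq B k).symm ▸ ithLargestEig_transpose_mul_self_pos B hk hrank
  have hC0 := specNorm_nonneg C
  have hB0 := specNorm_nonneg (B - Bhat)
  refine ContinuousLinearMap.opNorm_le_bound _ (by positivity) fun x => ?_
  change ‖toEuclideanLin (A - Ahat) x‖ ≤ _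
  have hBx := norm_toEuclideanLin_le_specNorm (B - Bhat) x
  have hCx := norm_toEuclideanLin_le_specNorm C x
  rw [hAhat, toEuclideanLin_sub_colSub_mul]
  nth_rw 1 [hBhat] at hBx
  rw [toEuclideanLin_sub_colSub_mul] at hBx
  set y := x - toEuclideanLin (colSub (1 : Matrix (Fin n) (Fin n) ℝ) I hI)
    (toEuclideanLin C x)
  have hyx : ‖y‖ ≤ (1 + specNorm C) * ‖x‖ := by
    have h := norm_sub_le x (toEuclideanLin (colSub (1 : Matrix (Fin n) (Fin n) ℝ) I hI)
      (toEuclideanLin C x))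
    rw [norm_toEuclideanLin_colSub_one] at h
    linarith
  obtain ⟨u, w, huw, hwy, hBu, hσu, hσw⟩ := exists_add_eq_of_singularValue B hk hkn y
  have hAw : ‖toEuclideanLin A w‖ ≤ √(τ * singularValue B (k + 1) ^ 2 + ε) * ‖w‖ :=
    le_sqrt_mul_of_sq_le (norm_nonneg _) (by nlinarith [hA w, mul_le_mul_of_nonneg_left hσw hτ])
  have hAu : ‖toEuclideanLin A u‖ ≤
      √(τ + ε * ((singularValue B k)⁻¹) ^ 2) * ‖toEuclideanLin B u‖ := by
    refine le_sqrt_mul_of_sq_le (norm_nonneg _) ?_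
    have hu : ‖u‖ ^ 2 ≤ ((singularValue B k)⁻¹) ^ 2 * ‖toEuclideanLin B u‖ ^ 2 := by
      rw [inv_pow, inv_mul_eq_div, le_div_iff₀ hσ]
      linarith
    nlinarith [hA u, mul_le_mul_of_nonneg_left hu hε0]
  have hw : ‖w‖ ≤ (1 + specNorm C) * ‖x‖ :=
    (pow_le_pow_iff_left₀ (norm_nonneg _) (norm_nonneg _) two_ne_zero |>.1 hwy).trans hyx
  have hu : ‖toEuclideanLin B u‖ ≤ specNorm (B - Bhat) * ‖x‖ :=
    (pow_le_pow_iff_left₀ (norm_nonneg _) (norm_nonneg _) two_ne_zero |>.1 hBu).trans hBx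
  calc ‖toEuclideanLin A y‖ ≤ ‖toEuclideanLin A u‖ + ‖toEuclideanLin A w‖ := by
        rw [← huw, map_add]
        exact norm_add_le _ _
    _ ≤ √(τ + ε * ((singularValue B k)⁻¹) ^ 2) * (specNorm (B - Bhat) * ‖x‖) +
        √(τ * singularValue B (k + 1) ^ 2 + ε) * ((1 + specNorm C) * ‖x‖) := by
        gcongr
        · exact hAu.trans (by gcongr)
        · exact hAw.trans (by gcongr)
    _ = _ := by ring
end
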